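/- Let G be a stepping sequence for m and fix k with 1 ≤ k ≤ m − 1. Consider the list consisting of the initial prefix set S_k = {1,…,k} followed by the generated sets of cardinality k, in the order they are produced. Then this list contains every k-element subset of {1,…,m} exactly once, and any two consecutive sets in this list have intersection of cardinality k − 1 (i.e., they differ by exactly one element). -/

import Mathlib

open List

/-- The initial configuration `(1, 2, …, m)`. -/
def initConfig (m : ℕ) : List ℕ := (List.range m).map (· + 1)

/-- A move at index `i` (with `1 ≤ i ≤ m-1`) transposes the entries `q_i` and `q_{i+1}`
(one-indexed), i.e. the entries at zero-indexed positions `i-1` and `i`. -/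
def swapAdj (q : List ℕ) (i : ℕ) : List ℕ :=
  (q.set (i - 1) (q.getD i 0)).set i (q.getD (i - 1) 0)

/-- The prefix set `S_k(q) = {q_1, …, q_k}`. -/
def prefixSet (q : List ℕ) (k : ℕ) : Finset ℕ := (q.take k).toFinset

/-- The initial prefix sets `S_0 ⊂ S_1 ⊂ … ⊂ S_m` of the configuration `(1,…,m)`. -/
def initSets (m : ℕ) : List (Finset ℕ) :=
  (List.range (m + 1)).map (fun k => prefixSet (initConfig m) k)

/-- The sets generated by applying a sequence of moves starting from configuration `q`:
the `t`-th generated set is the prefix set of length `i_t` of the configuration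
obtained after the `t`-th move. -/
def genSetsAux (q : List ℕ) : List ℕ → List (Finset ℕ)
  | [] => []
  | i :: rest => prefixSet (swapAdj q i) i :: genSetsAux (swapAdj q i) rest

/-- The sets generated by the moves, starting from the initial configuration `(1,…,m)`. -/
def genSets (m : ℕ) (moves : List ℕ) : List (Finset ℕ) :=
  genSetsAux (initConfig m) moves

/-- `moves` is a stepping sequence for `m`: each move index lies in `{1,…,m-1}`, and the
initial prefix sets `S_0,…,S_m` together with the generated sets list every subset of
`{1,…,m}` exactly once. -/
def IsSteppingSeq (m : ℕ) (moves : List ℕ) : Prop :=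
  (∀ i ∈ moves, 1 ≤ i ∧ i ≤ m - 1) ∧
  (initSets m ++ genSets m moves).Perm (Finset.Icc 1 m).powerset.toList

/-- An adjacent transposition in split form. -/
theorem exists_swapAdj_eq_append (q : List ℕ) {i : ℕ} (hi : 1 ≤ i) (hiq : i < q.length) :
    ∃ l a b r, l.length + 1 = i ∧ q = l ++ a :: b :: r ∧ swapAdj q i = l ++ b :: a :: r := by
  obtain ⟨j, rfl⟩ : ∃ j, i = j + 1 := ⟨i - 1, by omega⟩
  have hq : q = q.take j ++ q[j] :: q[j + 1] :: q.drop (j + 2) := by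
    rw [← List.drop_eq_getElem_cons hiq, ← List.drop_eq_getElem_cons, List.take_append_drop]
  have hl : (q.take j).length = j := by simp; omega
  generalize q.take j = l at hq hl
  generalize q[j] = a at hq
  generalize q[j + 1] = b at hq
  generalize q.drop (j + 2) = r at hq
  refine ⟨l, a, b, r, by omega, hq, ?_⟩
  subst hq hl
  simp [swapAdj, List.set_append_right]

theorem swapAdj_perm (q : List ℕ) {i : ℕ} (hi : 1 ≤ i) (hiq : i < q.length) :
    (swapAdj q i).Perm q := by
  obtain ⟨l, a, b, r, -, hq, hs⟩ := exists_swapAdj_eq_append q hi hiq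
  rw [hs, hq]
  exact (List.Perm.swap a b r).append_left l

theorem card_prefixSet {q : List ℕ} (hq : q.Nodup) {k : ℕ} (hk : k ≤ q.length) :
    (prefixSet q k).card = k := by
  rw [prefixSet, List.toFinset_card_of_nodup (hq.sublist (List.take_sublist k q)),
    List.length_take, min_eq_left hk]

/-- A move at index `i` leaves every prefix set of length `k ≠ i` unchanged. -/
theorem prefixSet_swapAdj_of_ne (q : List ℕ) {i k : ℕ} (hi : 1 ≤ i) (hiq : i < q.length)
    (hik : i ≠ k) : prefixSet (swapAdj q i) k = prefixSet q k := by
  obtain ⟨l, a, b, r, hl, hq, hs⟩ := exists_swapAdj_eq_append q hi hiq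
  rw [hs, hq, prefixSet, prefixSet]
  rcases lt_or_gt_of_ne hik with h | h
  · obtain ⟨d, rfl⟩ : ∃ d, k = l.length + (d + 2) := ⟨k - l.length - 2, by omega⟩
    ext x
    simp only [List.take_length_add_append, List.take_succ_cons, List.mem_toFinset,
      List.mem_append, List.mem_cons]
    tauto
  · rw [List.take_append_of_le_length (by omega), List.take_append_of_le_length (by omega)]

/-- A move at index `k` exchanges exactly one element of the prefix set of length `k`. -/
theorem card_prefixSet_inter_swapAdj {q : List ℕ} (hq : q.Nodup) {k : ℕ} (hk : 1 ≤ k)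
    (hkq : k < q.length) : (prefixSet q k ∩ prefixSet (swapAdj q k) k).card = k - 1 := by
  obtain ⟨l, a, b, r, rfl, rfl, hs⟩ := exists_swapAdj_eq_append q hk hkq
  have hinter : prefixSet (l ++ a :: b :: r) (l.length + 1) ∩
      prefixSet (l ++ b :: a :: r) (l.length + 1) = l.toFinset := by
    have hab : a ≠ b := by
      rintro rfl
      simp [List.nodup_append] at hq
    ext x
    simp only [prefixSet, List.take_length_add_append, List.take_succ_cons, List.take_zero,
      Finset.mem_inter, List.mem_toFinset, List.mem_append, List.mem_singleton]
    grind
  rw [hs, hinter, List.toFinset_card_of_nodup hq.of_append_left, Nat.add_sub_cancel]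

/-- Along any sequence of moves, consecutive prefix sets of length `k` meet in `k - 1` elements. -/
theorem isChain_prefixSet_cons_filter_genSetsAux {k : ℕ} (hk : 1 ≤ k) (G : List ℕ) {q : List ℕ}
    (hq : q.Nodup) (hkq : k < q.length) (hG : ∀ i ∈ G, 1 ≤ i ∧ i < q.length) :
    List.IsChain (fun A B : Finset ℕ => (A ∩ B).card = k - 1)
      (prefixSet q k :: (genSetsAux q G).filter (fun T => T.card = k)) := by
  induction G generalizing q with
  | nil => simp [genSetsAux]
  | cons i G ih =>
    obtain ⟨hi, hiq⟩ := hG i (by simp)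
    have hperm := swapAdj_perm q hi hiq
    have hchain := ih (hperm.nodup_iff.mpr hq) (by rwa [hperm.length_eq])
      fun j hj => by rw [hperm.length_eq]; exact hG j (by simp [hj])
    have hcard : (prefixSet (swapAdj q i) i).card = i :=
      card_prefixSet (hperm.nodup_iff.mpr hq) (by rw [hperm.length_eq]; exact hiq.le)
    by_cases hik : i = k
    · subst hik
      rw [genSetsAux, List.filter_cons_of_pos (by simpa using hcard), List.isChain_cons_cons]
      exact ⟨card_prefixSet_inter_swapAdj hq hi hiq, hchain⟩
    · rw [genSetsAux, List.filter_cons_of_neg (by simpa [hcard] using hik)]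
      rwa [prefixSet_swapAdj_of_ne q hi hiq hik] at hchain

theorem nodup_initConfig (m : ℕ) : (initConfig m).Nodup :=
  List.nodup_range.map (add_left_injective 1)

theorem length_initConfig (m : ℕ) : (initConfig m).length = m := by simp [initConfig]

theorem prefixSet_initConfig {m k : ℕ} (hk : k ≤ m) :
    prefixSet (initConfig m) k = Finset.Icc 1 k := by
  ext x
  simp only [prefixSet, initConfig, ← List.map_take, List.take_range, min_eq_left hk,
    List.mem_toFinset, List.mem_map, List.mem_range, Finset.mem_Icc]
  exact ⟨by rintro ⟨y, hy, rfl⟩; omega, fun h => ⟨x - 1, by omega, by omega⟩⟩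

theorem filter_card_initSets {m k : ℕ} (hk : k ≤ m) :
    (initSets m).filter (fun T => T.card = k) = [Finset.Icc 1 k] := by
  have hinit : initSets m = (List.range (m + 1)).map (Finset.Icc 1) :=
    List.map_congr_left fun j hj =>
      prefixSet_initConfig (Nat.lt_succ_iff.mp (List.mem_range.mp hj))
  have hfilter : (List.range (m + 1)).filter (fun j => j = k) = [k] := by
    rw [List.filter_eq, List.count_eq_one_of_mem List.nodup_range (by simp; omega),
      List.replicate_one]
  rw [hinit, List.filter_map]
  simp [Function.comp_def, hfilter]

theorem Finset.filter_toList_perm {α : Type*} (s : Finset α) (p : α → Prop) [DecidablePred p] :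
    (s.toList.filter (fun a => p a)).Perm (s.filter p).toList :=
  (List.perm_ext_iff_of_nodup (s.nodup_toList.filter _) (Finset.nodup_toList _)).mpr
    fun a => by simp

/-- A stepping sequence induces a Gray code through `k`-element subsets: the list
consisting of `S_k = {1,…,k}` followed by the generated sets of cardinality `k`, in
order, contains every `k`-element subset of `{1,…,m}` exactly once, and consecutive
sets in this list meet in exactly `k - 1` elements. -/
theorem stepping_induces_kSubset_grayCode (m k : ℕ) (hm : 2 ≤ m)
    (hk1 : 1 ≤ k) (hk2 : k ≤ m - 1) (G : List ℕ) (hG : IsSteppingSeq m G) :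
    (Finset.Icc 1 k :: (genSets m G).filter (fun T => T.card = k)).Perm
        (((Finset.Icc 1 m).powerset.filter (fun T => T.card = k)).toList) ∧
    ∀ t, t + 1 < (Finset.Icc 1 k :: (genSets m G).filter (fun T => T.card = k)).length →
      (((Finset.Icc 1 k :: (genSets m G).filter (fun T => T.card = k)).getD t ∅) ∩
        ((Finset.Icc 1 k :: (genSets m G).filter (fun T => T.card = k)).getD (t + 1) ∅)).card
        = k - 1 := by
  obtain ⟨hmoves, hperm⟩ := hG
  constructor
  · have h := hperm.filter (fun T => decide (T.card = k))
    rw [List.filter_append, filter_card_initSets (by omega)] at h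
    exact h.trans (Finset.filter_toList_perm _ _)
  · intro t ht
    have hchain := isChain_prefixSet_cons_filter_genSetsAux hk1 G (nodup_initConfig m)
      (by rw [length_initConfig]; omega)
      (fun i hi => by rw [length_initConfig]; have := hmoves i hi; omega)
    rw [prefixSet_initConfig (by omega), List.isChain_iff_getElem] at hchain
    rw [List.getD_eq_getElem _ _ (by omega), List.getD_eq_getElem _ _ ht]
    exact hchain t ht
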